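/- arXiv:1406.0236 — 4 statements merged into one kernel-verified Lean document; each statement's English description precedes it below -/
import Mathlib

section
/- Let κ ∈ ℝ and let μ be a finite complex measure on ℝ³ with compact support K. Define u(x) = ∫ φ_κ(x,y) dμ(y) for x ∉ K, where φ_κ(x,y) = e^{iκ‖x−y‖}/(4π‖x−y‖). Then u satisfies the outgoing radiation condition: there exist constants C > 0 and R > 0 such that for all x ∈ ℝ³ with ‖x‖ ≥ R, |⟨x/‖x‖, ∇u(x)⟩ − iκ u(x)| ≤ C/‖x‖. -/
noncomputable section

open Real MeasureTheory

/-- Three-dimensional Euclidean space. -/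
abbrev R3 := EuclideanSpace ℝ (Fin 3)

/-- The free-space fundamental solution of the Helmholtz equation with wave number κ,
`φ_κ(x,y) = e^{iκ‖x−y‖}/(4π‖x−y‖)`, as a function of the target point `x`. -/
def phi (κ : ℝ) (y : R3) (x : R3) : ℂ :=
  Complex.exp (Complex.I * (κ : ℂ) * (‖x - y‖ : ℝ)) / (4 * (Real.pi : ℂ) * (‖x - y‖ : ℝ))

/-- The derivative of the radial profile `r ↦ e^{iκr}/(4πr)` of the fundamental solution. -/
def phiProfileDeriv (κ r : ℝ) : ℂ :=
  (Complex.I * κ - (r : ℂ)⁻¹) * (Complex.exp (Complex.I * κ * r) / (4 * (Real.pi : ℂ) * r))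

/-- The Fréchet derivative of `phi κ y` at `z ≠ y`. -/
def phiFDeriv (κ : ℝ) (y z : R3) : R3 →L[ℝ] ℂ :=
  (‖z - y‖⁻¹ • innerSL ℝ (z - y)).smulRight (phiProfileDeriv κ ‖z - y‖)

lemma hasDerivAt_phiProfile (κ : ℝ) {r : ℝ} (hr : r ≠ 0) :
    HasDerivAt (fun r : ℝ => Complex.exp (Complex.I * κ * r) / (4 * (Real.pi : ℂ) * r))
      (phiProfileDeriv κ r) r := by
  have hr' : (r : ℂ) ≠ 0 := by exact_mod_cast hr
  have hpi : (Real.pi : ℂ) ≠ 0 := by exact_mod_cast Real.pi_ne_zero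
  have hid : HasDerivAt (fun r : ℝ => (r : ℂ)) 1 r := Complex.ofRealCLM.hasDerivAt
  have h := ((hid.const_mul (Complex.I * (κ : ℂ))).cexp).div
    (hid.const_mul (4 * (Real.pi : ℂ))) (by simp [hr', hpi])
  refine h.congr_deriv ?_
  unfold phiProfileDeriv
  field_simp

lemma hasFDerivAt_norm_sub {y z : R3} (h : z ≠ y) :
    HasFDerivAt (fun z : R3 => ‖z - y‖) (‖z - y‖⁻¹ • innerSL ℝ (z - y)) z := by
  have hn : ‖z - y‖ ≠ 0 := norm_ne_zero_iff.mpr (sub_ne_zero.mpr h)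
  have h1 := ((hasFDerivAt_id (𝕜 := ℝ) z).sub_const y).norm_sq.sqrt (pow_ne_zero 2 hn)
  simp only [id, Real.sqrt_sq (norm_nonneg _)] at h1
  refine h1.congr_fderiv ?_
  ext v
  simp
  field_simp

lemma hasFDerivAt_phi (κ : ℝ) {y z : R3} (h : z ≠ y) :
    HasFDerivAt (phi κ y) (phiFDeriv κ y z) z := by
  have hn : ‖z - y‖ ≠ 0 := norm_ne_zero_iff.mpr (sub_ne_zero.mpr h)
  have h1 := (hasDerivAt_phiProfile κ hn).hasFDerivAt.comp z (hasFDerivAt_norm_sub h)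
  refine HasFDerivAt.congr_fderiv (f := phi κ y) h1 ?_
  ext v
  simp [phiFDeriv]
  ring

lemma norm_phi_le (κ : ℝ) (y z : R3) : ‖phi κ y z‖ ≤ ‖z - y‖⁻¹ := by
  have he : ‖Complex.exp (Complex.I * κ * (‖z - y‖ : ℝ))‖ = 1 := by
    rw [Complex.norm_exp]; simp
  unfold phi
  rw [norm_div, he, norm_mul, norm_mul, Complex.norm_real, Complex.norm_real, norm_norm,
    Real.norm_of_nonneg Real.pi_pos.le, one_div, mul_inv]
  refine mul_le_of_le_one_left (by positivity) (inv_le_one_of_one_le₀ ?_)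
  norm_num
  linarith [Real.pi_gt_three]

lemma norm_phiFDeriv_le (κ : ℝ) {y z : R3} (h : 1 ≤ ‖z - y‖) :
    ‖phiFDeriv κ y z‖ ≤ (|κ| + 1) * ‖z - y‖⁻¹ := by
  have hc : ‖(‖z - y‖⁻¹ • innerSL ℝ (z - y) : R3 →L[ℝ] ℝ)‖ ≤ 1 := by
    rw [norm_smul, innerSL_apply_norm, norm_inv, norm_norm]
    exact inv_mul_le_one
  have hp : ‖Complex.I * (κ : ℂ) - ((‖z - y‖ : ℝ) : ℂ)⁻¹‖ ≤ |κ| + 1 := by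
    refine (norm_sub_le _ _).trans (add_le_add (by simp) ?_)
    rw [norm_inv, Complex.norm_real, norm_norm]
    exact inv_le_one_of_one_le₀ h
  rw [phiFDeriv, ContinuousLinearMap.norm_smulRight_apply]
  refine (mul_le_of_le_one_left (norm_nonneg _) hc).trans ?_
  rw [phiProfileDeriv, norm_mul]
  exact mul_le_mul hp (norm_phi_le κ y z) (norm_nonneg _) (by positivity)

lemma measurable_phi (κ : ℝ) (z : R3) : Measurable fun y => phi κ y z := by
  unfold phi
  fun_prop

lemma StronglyMeasurable.smulRight {α E F : Type*} [MeasurableSpace α]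
    [NormedAddCommGroup E] [NormedSpace ℝ E] [NormedAddCommGroup F] [NormedSpace ℝ F]
    {c : α → E →L[ℝ] ℝ} {v : α → F} (hc : StronglyMeasurable c) (hv : StronglyMeasurable v) :
    StronglyMeasurable fun a => (c a).smulRight (v a) :=
  (ContinuousLinearMap.smulRightL ℝ E F).continuous₂.comp_stronglyMeasurable (hc.prodMk hv)

lemma stronglyMeasurable_phiFDeriv (κ : ℝ) (z : R3) :
    StronglyMeasurable fun y => phiFDeriv κ y z := by
  have hn : StronglyMeasurable fun y : R3 => ‖z - y‖⁻¹ :=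
    Measurable.stronglyMeasurable (by fun_prop)
  have hi : StronglyMeasurable fun y : R3 => innerSL ℝ (z - y) :=
    ((innerSL ℝ).continuous.comp (continuous_const.sub continuous_id)).stronglyMeasurable
  have h2 : StronglyMeasurable fun y : R3 => phiProfileDeriv κ ‖z - y‖ := by
    unfold phiProfileDeriv
    have h3 : Measurable fun y : R3 => (Complex.I * κ - ((‖z - y‖ : ℝ) : ℂ)⁻¹) *
        (Complex.exp (Complex.I * κ * (‖z - y‖ : ℝ)) / (4 * (Real.pi : ℂ) * (‖z - y‖ : ℝ))) := by
      fun_prop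
    exact h3.stronglyMeasurable
  have h1 : StronglyMeasurable fun y : R3 => ‖z - y‖⁻¹ • innerSL ℝ (z - y) := hn.smul hi
  exact StronglyMeasurable.smulRight h1 h2

/-- Differentiation under the integral sign for the layer potential away from the support. -/
lemma hasFDerivAt_integral_phi (κ : ℝ) {ν : Measure R3} {f : R3 → ℂ} (hf : Integrable f ν)
    {x : R3} (hx : ∀ᵐ y ∂ν, 2 ≤ ‖x - y‖) :
    Integrable (fun y => f y * phi κ y x) ν ∧ Integrable (fun y => f y • phiFDeriv κ y x) ν ∧
      HasFDerivAt (fun z => ∫ y, f y * phi κ y z ∂ν) (∫ y, f y • phiFDeriv κ y x ∂ν) x := by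
  have hball : ∀ᵐ y ∂ν, ∀ z ∈ Metric.ball x 1, 1 ≤ ‖z - y‖ := by
    filter_upwards [hx] with y hy z hz
    have h1 : ‖x - y‖ ≤ ‖x - z‖ + ‖z - y‖ := norm_sub_le_norm_sub_add_norm_sub x z y
    rw [mem_ball_iff_norm'] at hz
    linarith
  have hmeas (z : R3) : AEStronglyMeasurable (fun y => f y * phi κ y z) ν :=
    hf.aestronglyMeasurable.mul (measurable_phi κ z).aestronglyMeasurable
  have hmeas' : AEStronglyMeasurable (fun y => f y • phiFDeriv κ y x) ν :=
    hf.aestronglyMeasurable.smul (stronglyMeasurable_phiFDeriv κ x).aestronglyMeasurable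
  have hbound : ∀ᵐ y ∂ν, ∀ z ∈ Metric.ball x 1, ‖f y • phiFDeriv κ y z‖ ≤ ‖f y‖ * (|κ| + 1) := by
    filter_upwards [hball] with y hy z hz
    rw [norm_smul]
    refine mul_le_mul_of_nonneg_left ((norm_phiFDeriv_le κ (hy z hz)).trans ?_) (norm_nonneg _)
    exact mul_le_of_le_one_right (by positivity) (inv_le_one_of_one_le₀ (hy z hz))
  have hxx : x ∈ Metric.ball x 1 := Metric.mem_ball_self one_pos
  have hint : Integrable (fun y => f y * phi κ y x) ν := by
    refine hf.mono (hmeas x) ?_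
    filter_upwards [hball] with y hy
    rw [norm_mul]
    exact mul_le_of_le_one_right (norm_nonneg _)
      ((norm_phi_le κ y x).trans (inv_le_one_of_one_le₀ (hy x hxx)))
  have hbint : Integrable (fun y => ‖f y‖ * (|κ| + 1)) ν := hf.norm.mul_const _
  refine ⟨hint, hbint.mono' hmeas' (hbound.mono fun y hy => hy x hxx), ?_⟩
  refine hasFDerivAt_integral_of_dominated_of_fderiv_le (F' := fun z y => f y • phiFDeriv κ y z)
    (Metric.ball_mem_nhds x one_pos) (Filter.Eventually.of_forall hmeas) hint hmeas' hbound hbint ?_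
  filter_upwards [hball] with y hy z hz
  refine (hasFDerivAt_phi κ ?_).const_mul (f y)
  rintro rfl
  have := hy z hz
  norm_num at this

/-- The layer potential `u(x) = ∫ φ_κ(x,y) dμ(y)` generated by a finite complex measure
`μ = f • ν` (every finite complex measure has this form, with `ν` a finite positive measure
and `f` an integrable complex density) supported in a compact set `K` satisfies the outgoing
radiation condition: `|∂u/∂r − iκu| ≤ C/‖x‖` for all sufficiently large `‖x‖`, the radial
derivative being the directional derivative in the direction `x/‖x‖`. -/
theorem layer_potential_radiation_condition (κ : ℝ) (ν : Measure R3) [IsFiniteMeasure ν]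
    (f : R3 → ℂ) (hf : Integrable f ν) (K : Set R3) (hK : IsCompact K)
    (hsupp : ν Kᶜ = 0) :
    ∃ C > (0 : ℝ), ∃ R > (0 : ℝ), ∀ x : R3, R ≤ ‖x‖ →
      ‖fderiv ℝ (fun z : R3 => ∫ y, f y * phi κ y z ∂ν) x ((‖x‖⁻¹ : ℝ) • x)
          - Complex.I * (κ : ℂ) * (∫ y, f y * phi κ y x ∂ν)‖ ≤ C / ‖x‖ := by
  obtain ⟨M, hM0, hM⟩ := hK.isBounded.exists_pos_norm_le
  have hKae : ∀ᵐ y ∂ν, y ∈ K := mem_ae_iff.mpr hsupp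
  have hI : 0 ≤ ∫ y, ‖f y‖ ∂ν := integral_nonneg fun _ => norm_nonneg _
  refine ⟨(∫ y, ‖f y‖ ∂ν) * ((2 * |κ| + 1) * 2) + 1, by positivity, 2 * M + 4, by positivity, ?_⟩
  intro x hx
  have hx0 : 0 < ‖x‖ := by linarith
  have hdist : ∀ᵐ y ∂ν, 2 ≤ ‖x - y‖ ∧ ‖x‖ / 2 ≤ ‖x - y‖ := by
    filter_upwards [hKae] with y hy
    have h1 := norm_sub_norm_le x y
    have h2 := hM y hy
    constructor <;> linarith
  obtain ⟨hint, hint', hderiv⟩ := hasFDerivAt_integral_phi κ hf (hdist.mono fun y hy => hy.1)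
  set e : R3 := (‖x‖⁻¹ : ℝ) • x with he
  have he1 : ‖e‖ = 1 := by
    rw [he, norm_smul, norm_inv, norm_norm, inv_mul_cancel₀ hx0.ne']
  rw [hderiv.fderiv, ContinuousLinearMap.integral_apply hint', ← integral_const_mul,
    ← integral_sub (hint'.apply_continuousLinearMap e) (hint.const_mul _)]
  calc _ ≤ ∫ y, ‖f y‖ * ((2 * |κ| + 1) * (2 / ‖x‖)) ∂ν := by
        refine norm_integral_le_of_norm_le (hf.norm.mul_const _) ?_
        filter_upwards [hdist] with y hy
        have hinv : ‖x - y‖⁻¹ ≤ 2 / ‖x‖ := by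
          rw [← inv_div]
          exact inv_anti₀ (by positivity) hy.2
        have h1 : ‖phiFDeriv κ y x e‖ ≤ (|κ| + 1) * ‖x - y‖⁻¹ := by
          refine ((phiFDeriv κ y x).le_opNorm e).trans ?_
          rw [he1, mul_one]
          exact norm_phiFDeriv_le κ (by linarith [hy.1])
        have h2 : ‖Complex.I * (κ : ℂ) * phi κ y x‖ ≤ |κ| * ‖x - y‖⁻¹ := by
          rw [norm_mul, norm_mul, Complex.norm_I, one_mul, Complex.norm_real, Real.norm_eq_abs]
          exact mul_le_mul_of_nonneg_left (norm_phi_le κ y x) (abs_nonneg κ)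
        have h3 : (f y • phiFDeriv κ y x) e - Complex.I * (κ : ℂ) * (f y * phi κ y x)
            = f y * (phiFDeriv κ y x e - Complex.I * (κ : ℂ) * phi κ y x) := by
          simp only [smul_apply, smul_eq_mul]
          ring
        rw [h3, norm_mul]
        refine mul_le_mul_of_nonneg_left ?_ (norm_nonneg _)
        calc _ ≤ (|κ| + 1) * ‖x - y‖⁻¹ + |κ| * ‖x - y‖⁻¹ :=
              (norm_sub_le _ _).trans (add_le_add h1 h2)
          _ = (2 * |κ| + 1) * ‖x - y‖⁻¹ := by ring
          _ ≤ _ := mul_le_mul_of_nonneg_left hinv (by positivity)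
    _ = ((∫ y, ‖f y‖ ∂ν) * ((2 * |κ| + 1) * 2)) / ‖x‖ := by
        rw [integral_mul_const]
        ring
    _ ≤ _ := by
        gcongr
        linarith
end
end

section
/- (Rellich-type uniqueness underlying well-posedness of the exterior scattering problem.) Let κ > 0 and R > 0, and let u : ℝ³ → ℂ be twice continuously differentiable on the exterior region {x ∈ ℝ³ : ‖x‖ > R} and satisfy the Helmholtz equation Δu + κ²u = 0 there. If the spherical surface integrals of |u|² tend to zero, i.e. ∫_{‖x‖=r} |u(x)|² dS(x) → 0 as r → ∞, then u(x) = 0 for every x with ‖x‖ > R. -/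
noncomputable section

open Real MeasureTheory Filter

/-- The Euclidean Laplacian of a complex-valued function on ℝ³:
the sum of the second partial derivatives along the coordinate directions. -/
def laplacian (u : R3 → ℂ) (x : R3) : ℂ :=
  ∑ i : Fin 3,
    fderiv ℝ (fun y => fderiv ℝ u y (EuclideanSpace.single i (1 : ℝ))) x
      (EuclideanSpace.single i (1 : ℝ))

/-- The surface measure of the unit sphere in `ℝ³`, as the restricted Hausdorff measure. -/
def sphereMeasure : Measure R3 := (μH[2] : Measure R3).restrict (Metric.sphere 0 1)

/-- The spherical coordinate parametrization of the unit sphere. -/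
def sphericalParam (p : ℝ × ℝ) : R3 :=
  !₂[sin p.1 * cos p.2, sin p.1 * sin p.2, cos p.1]

lemma sphericalParam_surjOn (x : R3) (hx : ‖x‖ = 1) :
    ∃ p ∈ Set.Icc 0 π ×ˢ Set.Icc (-π) π, sphericalParam p = x := by
  have h1 : x 0 ^ 2 + x 1 ^ 2 + x 2 ^ 2 = 1 := by
    have := EuclideanSpace.real_norm_sq_eq x
    rw [hx, Fin.sum_univ_three] at this
    linarith
  set z : ℂ := ⟨x 0, x 1⟩ with hz
  have hzn : ‖z‖ = √(1 - x 2 ^ 2) := by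
    rw [Complex.norm_def, Complex.normSq_apply]
    congr 1
    simp only [hz]
    linarith
  refine ⟨(arccos (x 2), z.arg),
    ⟨⟨arccos_nonneg _, arccos_le_pi _⟩, ⟨(Complex.neg_pi_lt_arg z).le, Complex.arg_le_pi z⟩⟩, ?_⟩
  ext i
  fin_cases i
  · simp [sphericalParam, sin_arccos, ← hzn, Complex.norm_mul_cos_arg, hz]
  · simp [sphericalParam, sin_arccos, ← hzn, Complex.norm_mul_sin_arg, hz]
  · simp only [sphericalParam]
    exact cos_arccos (by nlinarith [sq_nonneg (x 0), sq_nonneg (x 1)])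
      (by nlinarith [sq_nonneg (x 0), sq_nonneg (x 1)])

lemma contDiff_sphericalParam : ContDiff ℝ 1 sphericalParam := by
  rw [contDiff_euclidean]
  intro i
  fin_cases i
  · exact (contDiff_sin.comp contDiff_fst).mul (contDiff_cos.comp contDiff_snd)
  · exact (contDiff_sin.comp contDiff_fst).mul (contDiff_sin.comp contDiff_snd)
  · exact contDiff_cos.comp contDiff_fst

lemma hausdorffMeasure_unitSphere_lt_top :
    (μH[2] : Measure R3) (Metric.sphere 0 1) < ⊤ := by
  have hK : IsCompact (Set.Icc 0 π ×ˢ Set.Icc (-π) π) := isCompact_Icc.prod isCompact_Icc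
  obtain ⟨K, hL⟩ := contDiff_sphericalParam.locallyLipschitz.locallyLipschitzOn
    (s := Set.Icc 0 π ×ˢ Set.Icc (-π) π) |>.exists_lipschitzOnWith_of_compact hK
  have hsub : Metric.sphere (0 : R3) 1 ⊆ sphericalParam '' (Set.Icc 0 π ×ˢ Set.Icc (-π) π) :=
    fun x hx => sphericalParam_surjOn x (by simpa using hx)
  refine (measure_mono hsub).trans_lt
    ((hL.hausdorffMeasure_image_le (d := 2) (by norm_num)).trans_lt ?_)
  rw [hausdorffMeasure_prod_real]
  exact ENNReal.mul_lt_top (by simp) hK.measure_lt_top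

instance : IsFiniteMeasure sphereMeasure :=
  ⟨by simpa [sphereMeasure] using hausdorffMeasure_unitSphere_lt_top⟩

/-- Nonempty relatively open subsets of the unit sphere have positive surface measure. -/
lemma hausdorffMeasure_inter_unitSphere_pos {a : R3} (ha : ‖a‖ = 1) {U : Set R3} (hU : IsOpen U)
    (haU : a ∈ U) : 0 < (μH[2] : Measure R3) (U ∩ Metric.sphere 0 1) := by
  set W : Submodule ℝ R3 := (ℝ ∙ a)ᗮ
  have ha0 : a ≠ 0 := by rintro rfl; simp at ha
  have hfin : Module.finrank ℝ W = 2 := by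
    have : Fact (Module.finrank ℝ R3 = 2 + 1) := ⟨by simp⟩
    exact Submodule.finrank_orthogonal_span_singleton ha0
  have haW : ∀ w : W, inner ℝ (w : R3) a = 0 := fun w => by
    rw [real_inner_comm]; exact Submodule.mem_orthogonal_singleton_iff_inner_right.1 w.2
  let ψ : W → R3 := fun w => (w : R3) + √(1 - ‖w‖ ^ 2) • a
  have hψ : Continuous ψ := by fun_prop
  let N : Set W := ψ ⁻¹' U ∩ Metric.ball 0 1
  have hN : IsOpen N := (hU.preimage hψ).inter Metric.isOpen_ball
  have h0N : (0 : W) ∈ N := ⟨by simpa [ψ] using haU, by simp⟩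
  have hH : (μH[2] : Measure W).IsAddHaarMeasure := by
    have := isAddHaarMeasure_hausdorffMeasure (E := W)
    rw [hfin] at this
    simpa using this
  have hpos : 0 < (μH[2] : Measure W) N := hN.measure_pos _ ⟨0, h0N⟩
  have hsub : N ⊆ W.orthogonalProjectionOnto '' (U ∩ Metric.sphere 0 1) := by
    rintro w ⟨hwU, hw1⟩
    refine ⟨ψ w, ⟨hwU, ?_⟩, ?_⟩
    · have hw : ‖w‖ < 1 := by simpa using hw1
      have hnn : 0 ≤ 1 - ‖w‖ ^ 2 := by nlinarith [norm_nonneg w]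
      have : ‖ψ w‖ ^ 2 = 1 := by
        simp only [ψ]
        rw [norm_add_sq_real, inner_smul_right, haW, norm_smul, ha, Real.norm_eq_abs,
          mul_one, sq_abs, Real.sq_sqrt hnn]
        simp
      rw [mem_sphere_zero_iff_norm]
      nlinarith [norm_nonneg (ψ w)]
    · have haz : W.orthogonalProjectionOnto a = 0 := by
        rw [Submodule.orthogonalProjectionOnto_eq_zero_iff]
        exact Submodule.le_orthogonal_orthogonal _ (Submodule.mem_span_singleton_self a)
      simp [ψ, haz]
  exact hpos.trans_le ((measure_mono hsub).trans
    (hausdorffMeasure_orthogonalProjectionOnto_le W 2 _ (by norm_num)))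

lemma integrable_sphereMeasure_of_continuousOn {E : Type*} [NormedAddCommGroup E] {f : R3 → E}
    (hf : ContinuousOn f (Metric.sphere 0 1)) : Integrable f sphereMeasure := by
  have h := hf.integrableOn_compact (μ := sphereMeasure) (isCompact_sphere _ _)
  rwa [IntegrableOn, sphereMeasure, Measure.restrict_restrict Metric.isClosed_sphere.measurableSet,
    Set.inter_self] at h

open scoped Pointwise in
/-- Surface integrals over spheres of radius `r` in terms of the unit sphere. -/
lemma setIntegral_sphere_eq (f : R3 → ℝ) {r : ℝ} (hr : 0 < r) :
    ∫ x in Metric.sphere (0 : R3) r, f x ∂(μH[2]) = r ^ 2 * ∫ ω, f (r • ω) ∂sphereMeasure := by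
  have hmeas : MeasurableEmbedding (fun x : R3 => r • x) :=
    (Homeomorph.smulOfNeZero r hr.ne').measurableEmbedding
  have key : (μH[2] : Measure R3).restrict (Metric.sphere 0 r) =
      ENNReal.ofReal (r ^ 2) • Measure.map (fun x : R3 => r • x) sphereMeasure := by
    ext B hB
    rw [Measure.restrict_apply hB, Measure.smul_apply, hmeas.map_apply, sphereMeasure,
      Measure.restrict_apply (hmeas.measurable hB)]
    have : B ∩ Metric.sphere (0 : R3) r =
        r • ((fun x : R3 => r • x) ⁻¹' B ∩ Metric.sphere 0 1) := by
      ext x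
      rw [Set.mem_smul_set_iff_inv_smul_mem₀ hr.ne']
      simp only [Set.mem_inter_iff, mem_sphere_zero_iff_norm, Set.mem_preimage, smul_smul,
        mul_inv_cancel₀ hr.ne', one_smul, norm_smul, norm_inv, Real.norm_eq_abs, abs_of_pos hr]
      rw [inv_mul_eq_one₀ hr.ne', eq_comm (a := r)]
    rw [this, Measure.hausdorffMeasure_smul₀ (by norm_num) hr.ne']
    simp only [ENNReal.smul_def, smul_eq_mul]
    congr 1
    rw [ENNReal.ofReal, ENNReal.coe_inj]
    ext
    simp [abs_of_pos hr, sq_nonneg]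
  rw [key, integral_smul_measure, hmeas.integral_map, ENNReal.toReal_ofReal (by positivity),
    smul_eq_mul]

/-- Differentiation under the integral sign over the unit sphere. -/
lemma hasDerivAt_integral_sphereMeasure {K K' : ℝ → R3 → ℂ} {I : Set ℝ} (hI : IsOpen I)
    (hK : ∀ s ∈ I, ContinuousOn (K s) (Metric.sphere 0 1))
    (hK' : ContinuousOn (fun p : ℝ × R3 => K' p.1 p.2) (I ×ˢ Metric.sphere 0 1))
    (hd : ∀ s ∈ I, ∀ ω ∈ Metric.sphere (0 : R3) 1, HasDerivAt (fun s => K s ω) (K' s ω) s)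
    {s : ℝ} (hs : s ∈ I) :
    HasDerivAt (fun s => ∫ ω, K s ω ∂sphereMeasure) (∫ ω, K' s ω ∂sphereMeasure) s := by
  obtain ⟨ε, hε, hεI⟩ := Metric.nhds_basis_closedBall.mem_iff.1 (hI.mem_nhds hs)
  obtain ⟨C, hC⟩ := ((isCompact_closedBall s ε).prod
    (isCompact_sphere (0 : R3) 1)).exists_bound_of_continuousOn
    (hK'.mono (Set.prod_mono hεI subset_rfl))
  have hmem : ∀ᵐ ω ∂sphereMeasure, ω ∈ Metric.sphere (0 : R3) 1 :=
    ae_restrict_mem Metric.isClosed_sphere.measurableSet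
  refine (hasDerivAt_integral_of_dominated_loc_of_deriv_le (bound := fun _ => C)
    (Metric.closedBall_mem_nhds s hε) ?_ ?_ ?_ ?_ (integrable_const C) ?_).2
  · filter_upwards [hI.mem_nhds hs] with t ht
    exact (integrable_sphereMeasure_of_continuousOn (hK t ht)).1
  · exact integrable_sphereMeasure_of_continuousOn (hK s hs)
  · exact (integrable_sphereMeasure_of_continuousOn
      (hK'.comp (f := fun ω : R3 => (s, ω)) (by fun_prop) fun ω hω => ⟨hs, hω⟩)).1
  · filter_upwards [hmem] with ω hω t ht using hC (t, ω) ⟨ht, hω⟩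
  · filter_upwards [hmem] with ω hω t ht using hd t (hεI ht) ω hω

/-- The infinitesimal rotation in the plane of the coordinates `i` and `j`. -/
def rotGen (i j : Fin 3) : R3 →L[ℝ] R3 :=
  (EuclideanSpace.proj i).smulRight (EuclideanSpace.single j (1 : ℝ)) -
    (EuclideanSpace.proj j).smulRight (EuclideanSpace.single i (1 : ℝ))

lemma rotGen_apply (i j : Fin 3) (x : R3) :
    rotGen i j x =
      x i • EuclideanSpace.single j (1 : ℝ) - x j • EuclideanSpace.single i (1 : ℝ) := rfl

/-- The rotation by the angle `s` in the plane of the coordinates `i` and `j`. -/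
def rot (i j : Fin 3) (s : ℝ) : R3 →L[ℝ] R3 :=
  ContinuousLinearMap.id ℝ R3 + sin s • rotGen i j +
    (1 - cos s) • (rotGen i j ∘L rotGen i j)

lemma norm_rot {i j : Fin 3} (hij : i ≠ j) (s : ℝ) (x : R3) : ‖rot i j s x‖ = ‖x‖ := by
  rw [← sq_eq_sq₀ (norm_nonneg _) (norm_nonneg _), EuclideanSpace.real_norm_sq_eq,
    EuclideanSpace.real_norm_sq_eq, Fin.sum_univ_three, Fin.sum_univ_three]
  have h := sin_sq_add_cos_sq s
  fin_cases i <;> fin_cases j <;>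
    first
    | exact absurd rfl hij
    | (simp [rot, rotGen_apply]
       ring_nf
       rw [sin_sq]
       ring)

lemma measurePreserving_rot {i j : Fin 3} (hij : i ≠ j) (s : ℝ) :
    MeasurePreserving (rot i j s) sphereMeasure sphereMeasure := by
  let L : R3 →ₗᵢ[ℝ] R3 := ⟨(rot i j s).toLinearMap, norm_rot hij s⟩
  let e : R3 ≃ᵢ R3 := (L.toLinearIsometryEquiv rfl).toIsometryEquiv
  have he : ⇑e = rot i j s := rfl
  have h := (e.measurePreserving_hausdorffMeasure 2).restrict_preimage
    (s := Metric.sphere (0 : R3) 1) Metric.isClosed_sphere.measurableSet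
  have hpre : e ⁻¹' Metric.sphere (0 : R3) 1 = Metric.sphere 0 1 := by
    ext x
    simp [he, norm_rot hij]
  rwa [hpre, he] at h

lemma integral_comp_rot {i j : Fin 3} (hij : i ≠ j) (s : ℝ) (f : R3 → ℂ) :
    ∫ ω, f (rot i j s ω) ∂sphereMeasure = ∫ ω, f ω ∂sphereMeasure := by
  let L : R3 →ₗᵢ[ℝ] R3 := ⟨(rot i j s).toLinearMap, norm_rot hij s⟩
  have he : MeasurableEmbedding (rot i j s) :=
    (L.toLinearIsometryEquiv rfl).toHomeomorph.measurableEmbedding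
  exact (measurePreserving_rot hij s).integral_comp he f

lemma rot_apply (i j : Fin 3) (s : ℝ) (x : R3) :
    rot i j s x = x + sin s • rotGen i j x + (1 - cos s) • rotGen i j (rotGen i j x) := rfl

lemma continuous_rot (i j : Fin 3) : Continuous fun p : ℝ × R3 => rot i j p.1 p.2 := by
  simp only [rot_apply]
  fun_prop

lemma hasDerivAt_rot (i j : Fin 3) (s : ℝ) (x : R3) : HasDerivAt (fun s => rot i j s x)
    (cos s • rotGen i j x + sin s • rotGen i j (rotGen i j x)) s := by
  have h1 := ((hasDerivAt_sin s).smul_const (rotGen i j x)).const_add x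
  have h2 := ((hasDerivAt_cos s).const_sub 1).smul_const (rotGen i j (rotGen i j x))
  have h3 := h1.add h2
  rw [neg_neg] at h3
  exact h3

/-- The integral of an angular derivative over a sphere vanishes. -/
lemma integral_fderiv_rotGen_eq_zero {R r : ℝ} (hr : R < r) (hr0 : 0 < r) {F : R3 → ℂ}
    (hF : ContDiffOn ℝ 1 F {x : R3 | R < ‖x‖}) {i j : Fin 3} (hij : i ≠ j) :
    ∫ ω, fderiv ℝ F (r • ω) (rotGen i j (r • ω)) ∂sphereMeasure = 0 := by
  have hopen : IsOpen {x : R3 | R < ‖x‖} := isOpen_lt continuous_const continuous_norm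
  have hmaps : ∀ s, ∀ ω ∈ Metric.sphere (0 : R3) 1,
      r • rot i j s ω ∈ {x : R3 | R < ‖x‖} := fun s ω hω => by
    rw [mem_sphere_zero_iff_norm] at hω
    simpa [norm_smul, norm_rot hij, hω, abs_of_pos hr0] using hr
  have hrotc := continuous_rot i j
  have hDF : ContinuousOn (fderiv ℝ F) {x : R3 | R < ‖x‖} :=
    hF.continuousOn_fderiv_of_isOpen hopen le_rfl
  let K' : ℝ → R3 → ℂ := fun s ω => fderiv ℝ F (r • rot i j s ω)
      (r • (cos s • rotGen i j ω + sin s • rotGen i j (rotGen i j ω)))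
  have hK' : ContinuousOn (fun p : ℝ × R3 => K' p.1 p.2)
      (Set.univ ×ˢ Metric.sphere (0 : R3) 1) :=
    (hDF.comp (f := fun p : ℝ × R3 => r • rot i j p.1 p.2) (by fun_prop)
      fun p hp => hmaps p.1 p.2 hp.2).clm_apply (by fun_prop)
  have hderiv : HasDerivAt (fun s => ∫ ω, F (r • rot i j s ω) ∂sphereMeasure)
      (∫ ω, K' 0 ω ∂sphereMeasure) 0 := by
    refine hasDerivAt_integral_sphereMeasure (I := Set.univ) isOpen_univ
      (fun s _ => hF.continuousOn.comp (by fun_prop) (hmaps s)) hK' (fun s _ ω hω => ?_)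
      (Set.mem_univ (0 : ℝ))
    exact ((hF.differentiableOn one_ne_zero).differentiableAt
      (hopen.mem_nhds (hmaps s ω hω))).hasFDerivAt.comp_hasDerivAt s
      ((hasDerivAt_rot i j s ω).const_smul r)
  simp only [fun s => integral_comp_rot hij s fun ω => F (r • ω)] at hderiv
  have h0 := hderiv.unique (hasDerivAt_const _ _)
  simpa [K', rot_apply] using h0

/-- A real solution of `g'' + (κ² - c / r²) g = 0` with `c ≥ 0` that tends to zero at infinity
vanishes identically. -/
lemma eq_zero_of_ode_of_tendsto_zero {κ R c : ℝ} (hκ : 0 < κ) (hR : 0 < R) (hc : 0 ≤ c)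
    {g g' : ℝ → ℝ} (hg : ∀ r, R < r → HasDerivAt g (g' r) r)
    (hg' : ∀ r, R < r → HasDerivAt g' (-(κ ^ 2 - c / r ^ 2) * g r) r)
    (hlim : Tendsto g atTop (nhds 0)) : ∀ r, R < r → g r = 0 := by
  -- the energy is nondecreasing
  let E : ℝ → ℝ := fun r => g' r ^ 2 + (κ ^ 2 - c / r ^ 2) * g r ^ 2
  have hE : ∀ r, R < r → HasDerivAt E (2 * c / r ^ 3 * g r ^ 2) r := fun r hr => by
    have hr0 : r ≠ 0 := (hR.trans hr).ne'
    have h1 := (hg' r hr).pow 2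
    have h2 := ((hasDerivAt_pow 2 r).fun_inv (pow_ne_zero 2 hr0)).const_mul c |>.const_sub (κ ^ 2)
    have h3 := h1.add (h2.mul ((hg r hr).pow 2))
    refine (h3.congr_deriv ?_)
    simp only [Pi.pow_apply]
    field_simp
    ring
  have hEmono : MonotoneOn E (Set.Ioi R) := by
    refine monotoneOn_of_deriv_nonneg (convex_Ioi R)
      (fun r hr => (hE r hr).continuousAt.continuousWithinAt)
      (fun r hr => ?_) (fun r hr => ?_) <;> rw [interior_Ioi] at hr
    · exact (hE r hr).differentiableAt.differentiableWithinAt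
    · have hr0 : 0 < r := hR.trans hr
      rw [(hE r hr).deriv]
      positivity
  -- the energy tends to zero along a sequence
  have hξ : ∀ n : ℕ, ∃ ξ, R + 1 + n < ξ ∧ g' ξ = g (R + 1 + n + 1) - g (R + 1 + n) := fun n => by
    have hn : (0 : ℝ) ≤ n := n.cast_nonneg
    obtain ⟨ξ, hξ, h⟩ := exists_hasDerivAt_eq_slope g g' (lt_add_one (R + 1 + n))
      (fun r hr => (hg r (by linarith [hr.1])).continuousAt.continuousWithinAt)
      (fun r hr => hg r (by linarith [hr.1]))
    exact ⟨ξ, hξ.1, by simpa using h⟩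
  choose ξ hξlt hξg using hξ
  have htop : Tendsto (fun n : ℕ => R + 1 + n) atTop atTop :=
    tendsto_atTop_add_const_left _ _ tendsto_natCast_atTop_atTop
  have hξtop : Tendsto ξ atTop atTop := tendsto_atTop_mono (fun n => (hξlt n).le) htop
  have hg'ξ : Tendsto (fun n => g' (ξ n)) atTop (nhds 0) := by
    simp only [hξg]
    simpa using (hlim.comp (tendsto_atTop_add_const_right _ 1 htop)).sub (hlim.comp htop)
  have hcoef : Tendsto (fun r : ℝ => κ ^ 2 - c / r ^ 2) atTop (nhds (κ ^ 2)) := by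
    simpa using tendsto_const_nhds.sub
      (tendsto_const_nhds.div_atTop (tendsto_pow_atTop (α := ℝ) two_ne_zero))
  have hEξ : Tendsto (fun n => E (ξ n)) atTop (nhds 0) := by
    simpa using (hg'ξ.pow 2).add ((hcoef.comp hξtop).mul ((hlim.comp hξtop).pow 2))
  have hEle : ∀ r, R < r → E r ≤ 0 := fun r hr => by
    refine ge_of_tendsto hEξ ?_
    filter_upwards [hξtop.eventually_ge_atTop r] with n hn
    exact hEmono hr (hr.trans_le hn) hn
  have hlarge : ∀ᶠ r in atTop, R < r ∧ g r = 0 ∧ g' r = 0 := by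
    filter_upwards [hcoef.eventually_const_lt (sq_pos_of_pos hκ), eventually_gt_atTop R]
      with r hr hRr
    have h := hEle r hRr
    simp only [E] at h
    have h1 := mul_nonneg hr.le (sq_nonneg (g r))
    have h2 : (κ ^ 2 - c / r ^ 2) * g r ^ 2 = 0 := by nlinarith [sq_nonneg (g' r)]
    have h3 : g' r ^ 2 = 0 := by nlinarith [sq_nonneg (g' r)]
    exact ⟨hRr, by simpa [hr.ne'] using h2, by simpa using h3⟩
  -- backward uniqueness
  intro r hr
  obtain ⟨r₁, ⟨hr₁, hg₁, hg'₁⟩, hrr₁⟩ := (hlarge.and (eventually_ge_atTop r)).exists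
  set C : ℝ := 1 + κ ^ 2 + c / R ^ 2
  let W : ℝ → ℝ := fun t => exp (C * t) * (g' t ^ 2 + g t ^ 2)
  have hW : ∀ t, R < t → HasDerivAt W (exp (C * t) *
      (C * (g' t ^ 2 + g t ^ 2) + 2 * g t * g' t * (1 - κ ^ 2 + c / t ^ 2))) t := fun t ht => by
    have h1 := ((hasDerivAt_id t).const_mul C).exp
    have h2 := h1.mul (((hg' t ht).pow 2).add ((hg t ht).pow 2))
    refine h2.congr_deriv ?_
    simp only [Pi.pow_apply, Pi.add_apply, id]
    ring
  have hWmono : MonotoneOn W (Set.Ioi R) := by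
    refine monotoneOn_of_deriv_nonneg (convex_Ioi R)
      (fun t ht => (hW t ht).continuousAt.continuousWithinAt)
      (fun t ht => ?_) (fun t ht => ?_) <;> rw [interior_Ioi] at ht
    · exact (hW t ht).differentiableAt.differentiableWithinAt
    · rw [(hW t ht).deriv]
      have ht0 : 0 < t := hR.trans ht
      refine mul_nonneg (exp_pos _).le ?_
      have hb : c / t ^ 2 ≤ c / R ^ 2 := by
        have : R ≤ t := le_of_lt ht
        gcongr
      have hb0 : 0 ≤ c / t ^ 2 := by positivity
      set q := 1 - κ ^ 2 + c / t ^ 2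
      have hq1 : q ≤ C := by simp only [q, C]; nlinarith [sq_nonneg κ]
      have hq2 : -C ≤ q := by simp only [q, C]; nlinarith [sq_nonneg κ]
      nlinarith [mul_nonneg (sub_nonneg.2 hq1) (sq_nonneg (g' t - g t)),
        mul_nonneg (by linarith : 0 ≤ C + q) (sq_nonneg (g' t + g t))]
  have hle := hWmono hr hr₁ hrr₁
  simp only [W, hg₁, hg'₁] at hle
  have := exp_pos (C * r)
  have h0 : g' r ^ 2 + g r ^ 2 ≤ 0 := by
    by_contra! h
    nlinarith [mul_pos this h]
  nlinarith [sq_nonneg (g' r), sq_nonneg (g r), pow_eq_zero_iff (two_ne_zero) (a := g r)]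

lemma eq_sum_smul_single (x : R3) :
    x = x 0 • EuclideanSpace.single 0 (1 : ℝ) + x 1 • EuclideanSpace.single 1 (1 : ℝ) +
      x 2 • EuclideanSpace.single 2 (1 : ℝ) := by
  ext i
  fin_cases i <;> simp

lemma rotGen_rotGen_apply {i j : Fin 3} (hij : i ≠ j) (x : R3) : rotGen i j (rotGen i j x) =
    -(x i • EuclideanSpace.single i (1 : ℝ) + x j • EuclideanSpace.single j (1 : ℝ)) := by
  rw [rotGen_apply i j (rotGen i j x)]
  have h1 : rotGen i j x i = -x j := by simp [rotGen_apply, hij]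
  have h2 : rotGen i j x j = x i := by simp [rotGen_apply, hij.symm]
  rw [h1, h2]
  module

/-- The sum of the squared infinitesimal rotations, expressed through the trace and
the radial derivatives. -/
lemma sum_rotGen_sq (H : R3 →L[ℝ] R3 →L[ℝ] ℂ) (hH : ∀ v w, H v w = H w v) (D : R3 →L[ℝ] ℂ)
    (x : R3) :
    (H (rotGen 0 1 x) (rotGen 0 1 x) + D (rotGen 0 1 (rotGen 0 1 x))) +
      (H (rotGen 0 2 x) (rotGen 0 2 x) + D (rotGen 0 2 (rotGen 0 2 x))) +
      (H (rotGen 1 2 x) (rotGen 1 2 x) + D (rotGen 1 2 (rotGen 1 2 x))) =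
    (‖x‖ ^ 2 : ℝ) * ∑ i, H (EuclideanSpace.single i (1 : ℝ)) (EuclideanSpace.single i (1 : ℝ)) -
      H x x - 2 * D x := by
  have hx : ‖x‖ ^ 2 = x 0 ^ 2 + x 1 ^ 2 + x 2 ^ 2 := by
    rw [EuclideanSpace.real_norm_sq_eq, Fin.sum_univ_three]
  have hHxx : H x x = H (x 0 • EuclideanSpace.single 0 (1 : ℝ) +
      x 1 • EuclideanSpace.single 1 (1 : ℝ) + x 2 • EuclideanSpace.single 2 (1 : ℝ))
      (x 0 • EuclideanSpace.single 0 (1 : ℝ) +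
      x 1 • EuclideanSpace.single 1 (1 : ℝ) + x 2 • EuclideanSpace.single 2 (1 : ℝ)) := by
    rw [← eq_sum_smul_single]
  have hDx : D x = D (x 0 • EuclideanSpace.single 0 (1 : ℝ) +
      x 1 • EuclideanSpace.single 1 (1 : ℝ) + x 2 • EuclideanSpace.single 2 (1 : ℝ)) := by
    rw [← eq_sum_smul_single]
  rw [hx, hHxx, hDx, Fin.sum_univ_three, rotGen_rotGen_apply (by decide),
    rotGen_rotGen_apply (by decide), rotGen_rotGen_apply (by decide)]
  simp only [rotGen_apply, map_add, map_sub, map_smul, map_neg, add_apply, sub_apply, smul_apply,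
    Complex.real_smul]
  rw [hH (EuclideanSpace.single 1 1) (EuclideanSpace.single 0 1),
    hH (EuclideanSpace.single 2 1) (EuclideanSpace.single 0 1),
    hH (EuclideanSpace.single 2 1) (EuclideanSpace.single 1 1)]
  push_cast
  ring

lemma sum_inner_rotGen_sq (a x : R3) :
    inner ℝ a (rotGen 0 1 x) ^ 2 + inner ℝ a (rotGen 0 2 x) ^ 2 +
      inner ℝ a (rotGen 1 2 x) ^ 2 = ‖a‖ ^ 2 * ‖x‖ ^ 2 - inner ℝ a x ^ 2 := by
  rw [EuclideanSpace.real_norm_sq_eq, EuclideanSpace.real_norm_sq_eq]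
  simp [rotGen_apply, PiLp.inner_apply, Fin.sum_univ_three]
  ring

lemma sum_inner_rotGen_rotGen (a x : R3) :
    inner ℝ a (rotGen 0 1 (rotGen 0 1 x)) + inner ℝ a (rotGen 0 2 (rotGen 0 2 x)) +
      inner ℝ a (rotGen 1 2 (rotGen 1 2 x)) = -2 * inner ℝ a x := by
  simp [rotGen_apply, PiLp.inner_apply, Fin.sum_univ_three]
  ring

lemma isOpen_exterior (R : ℝ) : IsOpen {x : R3 | R < ‖x‖} :=
  isOpen_lt continuous_const continuous_norm

lemma laplacian_eq_sum {R : ℝ} {u : R3 → ℂ} (hu : ContDiffOn ℝ 2 u {x : R3 | R < ‖x‖})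
    {x : R3} (hx : R < ‖x‖) :
    laplacian u x = ∑ i, fderiv ℝ (fderiv ℝ u) x (EuclideanSpace.single i (1 : ℝ))
      (EuclideanSpace.single i (1 : ℝ)) := by
  have hD : DifferentiableAt ℝ (fderiv ℝ u) x :=
    ((hu.fderiv_of_isOpen (isOpen_exterior R) (m := 1) (by norm_num)).differentiableOn
      one_ne_zero).differentiableAt ((isOpen_exterior R).mem_nhds hx)
  refine Finset.sum_congr rfl fun i _ => ?_
  have h := hD.hasFDerivAt.clm_apply
    (hasFDerivAt_const (EuclideanSpace.single i (1 : ℝ) : R3) x)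
  rw [h.fderiv]
  simp

/-- The antisymmetrized angular derivative of `⟪a, x⟫ ^ d` and `u`. -/
def angularWronskian (a : R3) (d : ℕ) (u : R3 → ℂ) (i j : Fin 3) (x : R3) : ℂ :=
  (inner ℝ a x ^ d : ℝ) • fderiv ℝ u x (rotGen i j x) -
    (d * inner ℝ a x ^ (d - 1) * inner ℝ a (rotGen i j x) : ℝ) • u x

lemma contDiffOn_angularWronskian {R : ℝ} {u : R3 → ℂ}
    (hu : ContDiffOn ℝ 2 u {x : R3 | R < ‖x‖}) (a : R3) (d : ℕ) (i j : Fin 3) :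
    ContDiffOn ℝ 1 (angularWronskian a d u i j) {x : R3 | R < ‖x‖} := by
  have hD := hu.fderiv_of_isOpen (isOpen_exterior R) (m := 1) (by norm_num)
  have hu1 : ContDiffOn ℝ 1 u {x : R3 | R < ‖x‖} := hu.of_le (by norm_num)
  have hl : ContDiff ℝ 1 fun x : R3 => inner ℝ a x := contDiff_const.inner ℝ contDiff_id
  have hlA : ContDiff ℝ 1 fun x : R3 => inner ℝ a (rotGen i j x) :=
    contDiff_const.inner ℝ (rotGen i j).contDiff
  exact ((hl.pow d).contDiffOn.fun_smul (hD.clm_apply (rotGen i j).contDiff.contDiffOn)).sub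
    (((contDiff_const.mul (hl.pow (d - 1))).mul hlA).contDiffOn.fun_smul hu1)

lemma fderiv_angularWronskian {R : ℝ} {u : R3 → ℂ}
    (hu : ContDiffOn ℝ 2 u {x : R3 | R < ‖x‖}) (a : R3) (d : ℕ) (i j : Fin 3)
    {x : R3} (hx : R < ‖x‖) :
    fderiv ℝ (angularWronskian a d u i j) x (rotGen i j x) =
      (inner ℝ a x ^ d : ℝ) • (fderiv ℝ (fderiv ℝ u) x (rotGen i j x) (rotGen i j x) +
        fderiv ℝ u x (rotGen i j (rotGen i j x))) -
      (d * (d - 1 : ℕ) * inner ℝ a x ^ (d - 2) * inner ℝ a (rotGen i j x) ^ 2 +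
        d * inner ℝ a x ^ (d - 1) * inner ℝ a (rotGen i j (rotGen i j x)) : ℝ) • u x := by
  have hnhds := (isOpen_exterior R).mem_nhds hx
  have hD : HasFDerivAt (fderiv ℝ u) (fderiv ℝ (fderiv ℝ u) x) x :=
    (((hu.fderiv_of_isOpen (isOpen_exterior R) (m := 1) (by norm_num)).differentiableOn
      one_ne_zero).differentiableAt hnhds).hasFDerivAt
  have hu1 : HasFDerivAt u (fderiv ℝ u x) x :=
    ((hu.differentiableOn two_ne_zero).differentiableAt hnhds).hasFDerivAt
  have hl : HasFDerivAt (fun y => inner ℝ a y) (innerSL ℝ a) x := (innerSL ℝ a).hasFDerivAt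
  have hlA : HasFDerivAt (fun y => inner ℝ a (rotGen i j y)) ((innerSL ℝ a) ∘L rotGen i j) x :=
    ((innerSL ℝ a) ∘L rotGen i j).hasFDerivAt
  have h := ((hl.pow d).smul (hD.clm_apply (rotGen i j).hasFDerivAt)).sub
    ((((hl.pow (d - 1)).const_mul (d : ℝ)).mul hlA).smul hu1)
  have h' : HasFDerivAt (angularWronskian a d u i j) _ x := h
  rw [h'.fderiv]
  simp [Nat.sub_sub]
  ring

/-- Green's identity on spheres, with the spherical Laplacian of a solution of the Helmholtz
equation expressed through radial derivatives. -/
lemma sum_fderiv_angularWronskian {κ R : ℝ} {u : R3 → ℂ}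
    (hu : ContDiffOn ℝ 2 u {x : R3 | R < ‖x‖})
    (hhelm : ∀ x : R3, R < ‖x‖ → laplacian u x + (κ : ℂ) ^ 2 * u x = 0)
    {a : R3} (ha : ‖a‖ = 1) (d : ℕ) {r : ℝ} (hr : R < r) (hr0 : 0 < r) {ω : R3} (hω : ‖ω‖ = 1) :
    fderiv ℝ (angularWronskian a d u 0 1) (r • ω) (rotGen 0 1 (r • ω)) +
      fderiv ℝ (angularWronskian a d u 0 2) (r • ω) (rotGen 0 2 (r • ω)) +
      fderiv ℝ (angularWronskian a d u 1 2) (r • ω) (rotGen 1 2 (r • ω)) =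
    -(r ^ d : ℂ) * (r ^ 2 * ((inner ℝ a ω ^ d : ℝ) * fderiv ℝ (fderiv ℝ u) (r • ω) ω ω) +
      2 * r * ((inner ℝ a ω ^ d : ℝ) * fderiv ℝ u (r • ω) ω) +
      (κ ^ 2 * r ^ 2 - d * (d + 1)) * ((inner ℝ a ω ^ d : ℝ) * u (r • ω)) +
      d * (d - 1 : ℕ) * ((inner ℝ a ω ^ (d - 2) : ℝ) * u (r • ω))) := by
  have hnorm : ‖r • ω‖ = r := by rw [norm_smul, hω, mul_one, Real.norm_eq_abs, abs_of_pos hr0]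
  have hx : R < ‖r • ω‖ := by rwa [hnorm]
  have hsymm := ((hu.contDiffAt ((isOpen_exterior R).mem_nhds hx)).isSymmSndFDerivAt (by simp))
  have hsum := sum_rotGen_sq _ (fun v w => hsymm v w) (fderiv ℝ u (r • ω)) (r • ω)
  rw [← laplacian_eq_sum hu hx, eq_neg_of_add_eq_zero_left (hhelm _ hx), hnorm] at hsum
  have hsq := sum_inner_rotGen_sq a (r • ω)
  have hlin := sum_inner_rotGen_rotGen a (r • ω)
  rw [ha, hnorm] at hsq
  rw [fderiv_angularWronskian hu _ _ _ _ hx, fderiv_angularWronskian hu _ _ _ _ hx,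
    fderiv_angularWronskian hu _ _ _ _ hx]
  set t := inner ℝ a ω
  have ht : inner ℝ a (r • ω) = r * t := inner_smul_right _ _ _
  rw [ht] at hsq hlin ⊢
  have hscalar : (d * (d - 1 : ℕ) * (r * t) ^ (d - 2) * (inner ℝ a (rotGen 0 1 (r • ω)) ^ 2 +
      inner ℝ a (rotGen 0 2 (r • ω)) ^ 2 + inner ℝ a (rotGen 1 2 (r • ω)) ^ 2) +
      d * (r * t) ^ (d - 1) * (inner ℝ a (rotGen 0 1 (rotGen 0 1 (r • ω))) +
        inner ℝ a (rotGen 0 2 (rotGen 0 2 (r • ω))) +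
        inner ℝ a (rotGen 1 2 (rotGen 1 2 (r • ω)))) : ℝ) =
      r ^ d * (d * (d - 1 : ℕ) * t ^ (d - 2) - d * (d + 1) * t ^ d) := by
    rw [hsq, hlin]
    match d with
    | 0 => simp
    | 1 => simp; ring
    | n + 2 => simp; ring
  replace hscalar := congrArg Complex.ofReal hscalar
  simp only [map_smul, smul_apply, Complex.real_smul] at hsum hscalar ⊢
  push_cast at hsum hscalar ⊢
  linear_combination (r * t : ℂ) ^ d * hsum - u (r • ω) * hscalar

/-- The moment of order `d` in the direction `a` of a function on the unit sphere. -/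
def sphereMoment (a : R3) (d : ℕ) (v : R3 → ℂ) : ℂ :=
  ∫ ω, (inner ℝ a ω ^ d : ℝ) * v ω ∂sphereMeasure

lemma integrable_sphereMoment (a : R3) (d : ℕ) {v : R3 → ℂ}
    (hv : ContinuousOn v (Metric.sphere 0 1)) :
    Integrable (fun ω => ((inner ℝ a ω ^ d : ℝ) : ℂ) * v ω) sphereMeasure :=
  integrable_sphereMeasure_of_continuousOn
    (ContinuousOn.mul (Continuous.continuousOn (by fun_prop)) hv)

lemma mapsTo_smul_sphere {R r : ℝ} (hr : R < r) (hr0 : 0 < r) :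
    Set.MapsTo (fun ω : R3 => r • ω) (Metric.sphere 0 1) {x : R3 | R < ‖x‖} := fun ω hω => by
  rw [mem_sphere_zero_iff_norm] at hω
  simpa [norm_smul, hω, abs_of_pos hr0] using hr

section Moments

variable {R : ℝ} {u : R3 → ℂ}

lemma continuousOn_fderiv_exterior (hu : ContDiffOn ℝ 2 u {x : R3 | R < ‖x‖}) :
    ContinuousOn (fderiv ℝ u) {x : R3 | R < ‖x‖} :=
  hu.continuousOn_fderiv_of_isOpen (isOpen_exterior R) (by norm_num)

lemma continuousOn_fderiv_fderiv_exterior (hu : ContDiffOn ℝ 2 u {x : R3 | R < ‖x‖}) :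
    ContinuousOn (fderiv ℝ (fderiv ℝ u)) {x : R3 | R < ‖x‖} :=
  (hu.fderiv_of_isOpen (isOpen_exterior R) (m := 1) (by norm_num)).continuousOn_fderiv_of_isOpen
    (isOpen_exterior R) le_rfl

lemma hasDerivAt_sphereMoment (a : R3) (d : ℕ) {v v' : ℝ → R3 → ℂ}
    (hv : ∀ r, R < r → ContinuousOn (v r) (Metric.sphere 0 1))
    (hv' : ContinuousOn (fun p : ℝ × R3 => v' p.1 p.2) (Set.Ioi R ×ˢ Metric.sphere 0 1))
    (hd : ∀ r, R < r → ∀ ω ∈ Metric.sphere (0 : R3) 1,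
      HasDerivAt (fun r => v r ω) (v' r ω) r) {r : ℝ} (hr : R < r) :
    HasDerivAt (fun r => sphereMoment a d (v r)) (sphereMoment a d (v' r)) r :=
  hasDerivAt_integral_sphereMeasure (K := fun r ω => ((inner ℝ a ω ^ d : ℝ) : ℂ) * v r ω)
    (K' := fun r ω => ((inner ℝ a ω ^ d : ℝ) : ℂ) * v' r ω) isOpen_Ioi
    (fun s hs => ContinuousOn.mul (Continuous.continuousOn (by fun_prop)) (hv s hs))
    (ContinuousOn.mul (Continuous.continuousOn (by fun_prop)) hv')
    (fun s hs ω hω => (hd s hs ω hω).const_mul _) hr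

lemma hasDerivAt_sphereMoment_radial (hR : 0 < R) (hu : ContDiffOn ℝ 2 u {x : R3 | R < ‖x‖})
    (a : R3) (d : ℕ) {r : ℝ} (hr : R < r) :
    HasDerivAt (fun r => sphereMoment a d fun ω => u (r • ω))
      (sphereMoment a d fun ω => fderiv ℝ u (r • ω) ω) r := by
  refine hasDerivAt_sphereMoment (v := fun r ω => u (r • ω))
    (v' := fun r ω => fderiv ℝ u (r • ω) ω)
    a d
    (fun r hr => hu.continuousOn.comp (by fun_prop) (mapsTo_smul_sphere hr (hR.trans hr)))
    (((continuousOn_fderiv_exterior hu).comp (f := fun p : ℝ × R3 => p.1 • p.2) (by fun_prop)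
      fun p hp => mapsTo_smul_sphere hp.1 (hR.trans hp.1) hp.2).clm_apply (by fun_prop))
    (fun r hr ω hω => ?_) hr
  have h : HasDerivAt (fun r : ℝ => u (r • ω)) (fderiv ℝ u (r • ω) ((1 : ℝ) • ω)) r :=
    ((hu.differentiableOn two_ne_zero).differentiableAt ((isOpen_exterior R).mem_nhds
      (mapsTo_smul_sphere hr (hR.trans hr) hω))).hasFDerivAt.comp_hasDerivAt r
      ((hasDerivAt_id r).smul_const ω)
  rwa [one_smul] at h

lemma hasDerivAt_sphereMoment_radial_fderiv (hR : 0 < R)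
    (hu : ContDiffOn ℝ 2 u {x : R3 | R < ‖x‖}) (a : R3) (d : ℕ) {r : ℝ} (hr : R < r) :
    HasDerivAt (fun r => sphereMoment a d fun ω => fderiv ℝ u (r • ω) ω)
      (sphereMoment a d fun ω => fderiv ℝ (fderiv ℝ u) (r • ω) ω ω) r := by
  refine hasDerivAt_sphereMoment (v := fun r ω => fderiv ℝ u (r • ω) ω)
    (v' := fun r ω => fderiv ℝ (fderiv ℝ u) (r • ω) ω ω) a d
    (fun r hr => ((continuousOn_fderiv_exterior hu).comp (by fun_prop)
      (mapsTo_smul_sphere hr (hR.trans hr))).clm_apply (by fun_prop))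
    ((((continuousOn_fderiv_fderiv_exterior hu).comp (f := fun p : ℝ × R3 => p.1 • p.2)
      (by fun_prop) fun p hp => mapsTo_smul_sphere hp.1 (hR.trans hp.1) hp.2).clm_apply
      (by fun_prop)).clm_apply (by fun_prop))
    (fun r hr ω hω => ?_) hr
  have hD := ((hu.fderiv_of_isOpen (isOpen_exterior R) (m := 1) (by norm_num)).differentiableOn
    one_ne_zero).differentiableAt ((isOpen_exterior R).mem_nhds
      (mapsTo_smul_sphere hr (hR.trans hr) hω))
  have h1 : HasDerivAt (fun r : ℝ => fderiv ℝ u (r • ω))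
      (fderiv ℝ (fderiv ℝ u) (r • ω) ((1 : ℝ) • ω)) r :=
    hD.hasFDerivAt.comp_hasDerivAt r ((hasDerivAt_id r).smul_const ω)
  have h := h1.clm_apply (hasDerivAt_const r ω)
  rwa [one_smul, map_zero, add_zero] at h

/-- The radial ordinary differential equation satisfied by the moments. -/
lemma sphereMoment_ode {κ : ℝ} (hR : 0 < R) (hu : ContDiffOn ℝ 2 u {x : R3 | R < ‖x‖})
    (hhelm : ∀ x : R3, R < ‖x‖ → laplacian u x + (κ : ℂ) ^ 2 * u x = 0)
    {a : R3} (ha : ‖a‖ = 1) (d : ℕ) {r : ℝ} (hr : R < r) :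
    (r : ℂ) ^ 2 * sphereMoment a d (fun ω => fderiv ℝ (fderiv ℝ u) (r • ω) ω ω) +
      2 * r * sphereMoment a d (fun ω => fderiv ℝ u (r • ω) ω) +
      (κ ^ 2 * r ^ 2 - d * (d + 1)) * sphereMoment a d (fun ω => u (r • ω)) +
      d * (d - 1 : ℕ) * sphereMoment a (d - 2) (fun ω => u (r • ω)) = 0 := by
  have hr0 := hR.trans hr
  have hmaps := mapsTo_smul_sphere hr hr0
  have hc0 : ContinuousOn (fun ω : R3 => u (r • ω)) (Metric.sphere 0 1) :=
    hu.continuousOn.comp (by fun_prop) hmaps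
  have hc1 : ContinuousOn (fun ω : R3 => fderiv ℝ u (r • ω) ω) (Metric.sphere 0 1) :=
    ((continuousOn_fderiv_exterior hu).comp (by fun_prop) hmaps).clm_apply (by fun_prop)
  have hc2 : ContinuousOn (fun ω : R3 => fderiv ℝ (fderiv ℝ u) (r • ω) ω ω)
      (Metric.sphere 0 1) :=
    (((continuousOn_fderiv_fderiv_exterior hu).comp (by fun_prop) hmaps).clm_apply
      (by fun_prop)).clm_apply (by fun_prop)
  have hint : ∀ i j, Integrable (fun ω => fderiv ℝ (angularWronskian a d u i j) (r • ω)
      (rotGen i j (r • ω))) sphereMeasure := fun i j =>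
    integrable_sphereMeasure_of_continuousOn
      ((((contDiffOn_angularWronskian hu a d i j).continuousOn_fderiv_of_isOpen
        (isOpen_exterior R) le_rfl).comp (by fun_prop) hmaps).clm_apply (by fun_prop))
  have hzero : ∀ i j, i ≠ j → ∫ ω, fderiv ℝ (angularWronskian a d u i j) (r • ω)
      (rotGen i j (r • ω)) ∂sphereMeasure = 0 := fun i j hij =>
    integral_fderiv_rotGen_eq_zero hr hr0 (contDiffOn_angularWronskian hu a d i j) hij
  have hsum := integral_add ((hint 0 1).add (hint 0 2)) (hint 1 2)
  have hsum' := integral_add (hint 0 1) (hint 0 2)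
  simp only [Pi.add_apply] at hsum
  rw [hsum', hzero 0 1 (by decide), hzero 0 2 (by decide), hzero 1 2 (by decide)] at hsum
  have hae : ∀ᵐ ω ∂sphereMeasure, ω ∈ Metric.sphere (0 : R3) 1 :=
    ae_restrict_mem Metric.isClosed_sphere.measurableSet
  rw [integral_congr_ae (hae.mono fun ω hω => sum_fderiv_angularWronskian hu hhelm ha d hr hr0
    (mem_sphere_zero_iff_norm.1 hω)), integral_const_mul] at hsum
  have h2 := (integrable_sphereMoment a d hc2).const_mul ((r : ℂ) ^ 2)
  have h1 := (integrable_sphereMoment a d hc1).const_mul (2 * r : ℂ)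
  have h0 := (integrable_sphereMoment a d hc0).const_mul (κ ^ 2 * r ^ 2 - d * (d + 1) : ℂ)
  have hm := (integrable_sphereMoment a (d - 2) hc0).const_mul (d * (d - 1 : ℕ) : ℂ)
  rw [integral_add ((h2.fun_add h1).fun_add h0) hm, integral_add (h2.fun_add h1) h0,
    integral_add h2 h1, integral_const_mul, integral_const_mul, integral_const_mul, integral_const_mul] at hsum
  have hne : -(r ^ d : ℂ) ≠ 0 := neg_ne_zero.2 (pow_ne_zero _ (by exact_mod_cast hr0.ne'))
  rw [add_zero, add_zero] at hsum
  exact (mul_eq_zero.1 hsum).resolve_left hne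

/-- Cauchy–Schwarz bound for the moments by the surface integral of `|u|²`. -/
lemma sq_norm_smul_sphereMoment_le (hR : 0 < R) (hu : ContinuousOn u {x : R3 | R < ‖x‖})
    {a : R3} (ha : ‖a‖ = 1) (d : ℕ) {r : ℝ} (hr : R < r) :
    ‖(r : ℂ) * sphereMoment a d fun ω => u (r • ω)‖ ^ 2 ≤ (sphereMeasure.real Set.univ + 1) *
      ∫ x in Metric.sphere (0 : R3) r, ‖u x‖ ^ 2 ∂(μH[2]) := by
  have hr0 := hR.trans hr
  rw [setIntegral_sphere_eq _ hr0]
  have hc : ContinuousOn (fun ω : R3 => u (r • ω)) (Metric.sphere 0 1) :=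
    hu.comp (by fun_prop) (mapsTo_smul_sphere hr hr0)
  have hi1 := integrable_sphereMeasure_of_continuousOn hc.norm
  have hi2 : Integrable (fun ω => ‖u (r • ω)‖ ^ 2) sphereMeasure :=
    integrable_sphereMeasure_of_continuousOn (hc.norm.pow 2)
  set M := sphereMeasure.real Set.univ
  set F := ∫ ω, ‖u (r • ω)‖ ∂sphereMeasure
  set I := ∫ ω, ‖u (r • ω)‖ ^ 2 ∂sphereMeasure
  have hM : 0 ≤ M := measureReal_nonneg
  have hae : ∀ᵐ ω ∂sphereMeasure, ω ∈ Metric.sphere (0 : R3) 1 :=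
    ae_restrict_mem Metric.isClosed_sphere.measurableSet
  have hle : ‖sphereMoment a d fun ω => u (r • ω)‖ ≤ F := by
    refine norm_integral_le_of_norm_le hi1 (hae.mono fun ω hω => ?_)
    have h := abs_real_inner_le_norm a ω
    rw [ha, mem_sphere_zero_iff_norm.1 hω, one_mul] at h
    rw [norm_mul, Complex.norm_real, norm_pow, Real.norm_eq_abs]
    exact mul_le_of_le_one_left (norm_nonneg _) (pow_le_one₀ (abs_nonneg _) h)
  have hquad : ∀ t : ℝ, 2 * t * F ≤ I + t ^ 2 * M := fun t => by
    have h : ∫ ω, 2 * t * ‖u (r • ω)‖ ∂sphereMeasure ≤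
        ∫ ω, (‖u (r • ω)‖ ^ 2 + t ^ 2) ∂sphereMeasure :=
      integral_mono (hi1.const_mul _) (hi2.add (integrable_const _)) fun ω => by
        simp only
        nlinarith [sq_nonneg (‖u (r • ω)‖ - t)]
    rw [integral_const_mul, integral_add hi2 (integrable_const _), integral_const] at h
    simpa [mul_comm, M] using h
  have hF0 : 0 ≤ F := integral_nonneg fun _ => norm_nonneg _
  have hFI : F ^ 2 ≤ (M + 1) * I := by
    have h := mul_le_mul_of_nonneg_left (hquad (F / (M + 1))) (by positivity : 0 ≤ (M + 1) ^ 2)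
    field_simp at h
    nlinarith [sq_nonneg F]
  rw [norm_mul, Complex.norm_real, Real.norm_eq_abs, mul_pow, sq_abs]
  have h2 : ‖sphereMoment a d fun ω => u (r • ω)‖ ^ 2 ≤ F ^ 2 := by gcongr
  nlinarith [mul_le_mul_of_nonneg_left (h2.trans hFI) (sq_nonneg r)]

lemma sphereMoment_eq_zero {κ : ℝ} (hκ : 0 < κ) (hR : 0 < R)
    (hu : ContDiffOn ℝ 2 u {x : R3 | R < ‖x‖})
    (hhelm : ∀ x : R3, R < ‖x‖ → laplacian u x + (κ : ℂ) ^ 2 * u x = 0)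
    (hdecay : Tendsto (fun r : ℝ => ∫ x in Metric.sphere (0 : R3) r, ‖u x‖ ^ 2 ∂(μH[2]))
      atTop (nhds 0)) {a : R3} (ha : ‖a‖ = 1) (d : ℕ) :
    ∀ r, R < r → sphereMoment a d (fun ω => u (r • ω)) = 0 := by
  induction d using Nat.strong_induction_on with
  | _ d ih =>
  let g : ℝ → ℂ := fun r => r * sphereMoment a d fun ω => u (r • ω)
  let g' : ℝ → ℂ := fun r => (sphereMoment a d fun ω => u (r • ω)) +
    r * sphereMoment a d fun ω => fderiv ℝ u (r • ω) ω
  have hid : ∀ r : ℝ, HasDerivAt (fun r : ℝ => (r : ℂ)) 1 r := fun r =>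
    (hasDerivAt_id r).ofReal_comp
  have hg : ∀ r, R < r → HasDerivAt g (g' r) r := fun r hr =>
    ((hid r).mul (hasDerivAt_sphereMoment_radial hR hu a d hr)).congr_deriv (by simp [g'])
  have hg' : ∀ r, R < r → HasDerivAt g'
      ((-(κ ^ 2 - (d * (d + 1) : ℝ) / r ^ 2) : ℝ) * g r) r := fun r hr => by
    have hr0 : (r : ℂ) ≠ 0 := by exact_mod_cast (hR.trans hr).ne'
    refine ((hasDerivAt_sphereMoment_radial hR hu a d hr).add
      ((hid r).mul (hasDerivAt_sphereMoment_radial_fderiv hR hu a d hr))).congr_deriv ?_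
    have hode := sphereMoment_ode hR hu hhelm ha d hr
    have hlow : (d * (d - 1 : ℕ) : ℂ) * sphereMoment a (d - 2) (fun ω => u (r • ω)) = 0 := by
      match d, ih with
      | 0, _ => simp
      | 1, _ => simp
      | n + 2, ih => rw [Nat.add_sub_cancel, ih n (by omega) r hr, mul_zero]
    rw [hlow, add_zero] at hode
    simp only [g]
    push_cast
    field_simp
    linear_combination hode
  have hlim : Tendsto g atTop (nhds 0) := by
    have hsq : Tendsto (fun r => ‖g r‖ ^ 2) atTop (nhds 0) := by
      refine tendsto_of_tendsto_of_tendsto_of_le_of_le' tendsto_const_nhds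
        (by simpa using hdecay.const_mul (sphereMeasure.real Set.univ + 1))
        (Eventually.of_forall fun r => sq_nonneg _) ?_
      filter_upwards [eventually_gt_atTop R] with r hr
      exact sq_norm_smul_sphereMoment_le hR hu.continuousOn ha d hr
    rw [tendsto_zero_iff_norm_tendsto_zero]
    simpa using hsq.sqrt
  intro r hr
  have hre : (g r).re = 0 := by
    refine eq_zero_of_ode_of_tendsto_zero (c := d * (d + 1)) (g := fun r => (g r).re)
      (g' := fun r => (g' r).re) hκ hR (by positivity)
      (fun r hr => Complex.reCLM.hasFDerivAt.comp_hasDerivAt r (hg r hr)) (fun r hr => ?_)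
      ((Complex.continuous_re.tendsto 0).comp hlim) r hr
    exact (Complex.reCLM.hasFDerivAt.comp_hasDerivAt r (hg' r hr)).congr_deriv
      (Complex.re_ofReal_mul _ _)
  have him : (g r).im = 0 := by
    refine eq_zero_of_ode_of_tendsto_zero (c := d * (d + 1)) (g := fun r => (g r).im)
      (g' := fun r => (g' r).im) hκ hR (by positivity)
      (fun r hr => Complex.imCLM.hasFDerivAt.comp_hasDerivAt r (hg r hr)) (fun r hr => ?_)
      ((Complex.continuous_im.tendsto 0).comp hlim) r hr
    exact (Complex.imCLM.hasFDerivAt.comp_hasDerivAt r (hg' r hr)).congr_deriv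
      (Complex.im_ofReal_mul _ _)
  have hgr : g r = 0 := Complex.ext hre him
  simpa [g, (hR.trans hr).ne'] using hgr

end Moments

/-- A continuous function on the unit sphere all of whose moments in the direction `a` vanish
is zero at `a`. -/
lemma eq_zero_of_sphereMoment_eq_zero {a : R3} (ha : ‖a‖ = 1) {v : R3 → ℂ}
    (hv : ContinuousOn v (Metric.sphere 0 1)) (hmom : ∀ d, sphereMoment a d v = 0) : v a = 0 := by
  have haS : a ∈ Metric.sphere (0 : R3) 1 := mem_sphere_zero_iff_norm.2 ha
  have hrestr : sphereMeasure.restrict (Metric.sphere 0 1) = sphereMeasure := by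
    rw [sphereMeasure, Measure.restrict_restrict Metric.isClosed_sphere.measurableSet,
      Set.inter_self]
  have hpeak := tendsto_setIntegral_pow_smul_of_unique_maximum_of_isCompact_of_measure_nhdsWithin_pos
    (μ := sphereMeasure) (g := v) (x₀ := a) (isCompact_sphere (0 : R3) 1)
    (c := fun ω => inner ℝ a ω + 1) ?_ (by fun_prop) ?_ ?_ ?_ haS ?_ (hv a haS)
  · have hzero : ∀ n : ℕ, ∫ ω in Metric.sphere (0 : R3) 1, (inner ℝ a ω + 1) ^ n • v ω
        ∂sphereMeasure = 0 := fun n => by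
      rw [hrestr]
      have hexp : ∀ ω, (inner ℝ a ω + 1) ^ n • v ω = ∑ k ∈ Finset.range (n + 1),
          (n.choose k : ℂ) * ((inner ℝ a ω ^ k : ℝ) * v ω) := fun ω => by
        rw [add_pow, Finset.sum_smul]
        refine Finset.sum_congr rfl fun k _ => ?_
        rw [Complex.real_smul]
        push_cast
        ring
      simp only [hexp]
      rw [integral_finsetSum _ fun k _ => (integrable_sphereMoment a k hv).const_mul _]
      refine Finset.sum_eq_zero fun k _ => ?_
      rw [integral_const_mul]
      exact mul_eq_zero_of_right _ (hmom k)
    simp only [hzero, smul_zero] at hpeak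
    exact tendsto_nhds_unique hpeak tendsto_const_nhds
  · intro U hU haU
    rw [sphereMeasure, Measure.restrict_apply
      (hU.measurableSet.inter Metric.isClosed_sphere.measurableSet), Set.inter_assoc,
      Set.inter_self]
    exact hausdorffMeasure_inter_unitSphere_pos ha hU haU
  · intro ω hω hne
    simp only [add_lt_add_iff_right]
    rw [real_inner_self_eq_norm_sq, ha, one_pow]
    exact (inner_lt_one_iff_real_of_norm_eq_one ha (mem_sphere_zero_iff_norm.1 hω)).2 hne.symm
  · intro ω hω
    have h := neg_abs_le (inner ℝ a ω)
    have h' := abs_real_inner_le_norm a ω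
    rw [ha, mem_sphere_zero_iff_norm.1 hω] at h'
    linarith
  · rw [real_inner_self_eq_norm_sq, ha]
    norm_num
  · exact (integrable_sphereMeasure_of_continuousOn hv).integrableOn

/-- Rellich-type uniqueness: a twice continuously differentiable solution of the Helmholtz
equation `Δu + κ²u = 0` (κ > 0) on the exterior region `{‖x‖ > R}` whose spherical surface
integrals `∫_{‖x‖=r} |u|² dS` (taken with respect to two-dimensional Hausdorff measure)
tend to zero as `r → ∞` vanishes identically on the exterior region. -/
theorem rellich_uniqueness (κ R : ℝ) (hκ : 0 < κ) (hR : 0 < R) (u : R3 → ℂ)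
    (hreg : ContDiffOn ℝ 2 u {x : R3 | R < ‖x‖})
    (hhelm : ∀ x : R3, R < ‖x‖ → laplacian u x + (κ : ℂ) ^ 2 * u x = 0)
    (hdecay : Tendsto (fun r : ℝ => ∫ x in Metric.sphere (0 : R3) r, ‖u x‖ ^ 2 ∂(μH[2]))
      atTop (nhds 0)) :
    ∀ x : R3, R < ‖x‖ → u x = 0 := by
  intro x hx
  have hx0 := hR.trans hx
  have ha : ‖‖x‖⁻¹ • x‖ = 1 := by
    rw [norm_smul, norm_inv, norm_norm, inv_mul_cancel₀ hx0.ne']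
  have hcont : ContinuousOn (fun ω : R3 => u (‖x‖ • ω)) (Metric.sphere 0 1) :=
    hreg.continuousOn.comp (by fun_prop) (mapsTo_smul_sphere hx hx0)
  have h := eq_zero_of_sphereMoment_eq_zero ha hcont fun d =>
    sphereMoment_eq_zero hκ hR hreg hhelm hdecay ha d ‖x‖ hx
  simpa [smul_smul, hx0.ne'] using h
end
end

section
/- (Reduction to the compressed skeleton system.) Let m, n, k ≥ 1. For p, q ∈ {1,…,m} with p ≠ q, suppose the n×n complex matrices A_{p,q} factor exactly as A_{p,q} = U_p Ã_{p,q} V_q^*, where U_p, V_p are n×k complex matrices and Ã_{p,q} is k×k. Suppose each n×n diagonal block A_{p,p} is invertible, and that the block vectors σ_p, v_p ∈ ℂⁿ satisfy A_{p,p} σ_p + Σ_{q≠p} A_{p,q} σ_q = −v_p for all p. Define σ̃_p = V_p^* σ_p, ṽ_p = V_p^* A_{p,p}^{-1} v_p, and S_p = V_p^* A_{p,p}^{-1} U_p. Then for every p, σ̃_p + Σ_{q≠p} S_p Ã_{p,q} σ̃_q = −ṽ_p. -/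
noncomputable section

open Matrix

/-- Reduction to the compressed skeleton system: if the off-diagonal blocks factor as
`A_{p,q} = U_p Ã_{p,q} V_q^*`, the diagonal blocks are invertible, and the block vectors
`σ_p` solve the full multibody system, then the skeleton unknowns `σ̃_p = V_p^* σ_p`
solve the compressed system `σ̃_p + Σ_{q≠p} S_p Ã_{p,q} σ̃_q = −ṽ_p` with
`ṽ_p = V_p^* A_{p,p}⁻¹ v_p` and `S_p = V_p^* A_{p,p}⁻¹ U_p`. -/
theorem compressed_skeleton_system (m n k : ℕ) (hm : 1 ≤ m) (hn : 1 ≤ n) (hk : 1 ≤ k)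
    (A : Fin m → Fin m → Matrix (Fin n) (Fin n) ℂ)
    (U V : Fin m → Matrix (Fin n) (Fin k) ℂ)
    (Atil : Fin m → Fin m → Matrix (Fin k) (Fin k) ℂ)
    (hfac : ∀ p q : Fin m, p ≠ q → A p q = U p * Atil p q * (V q)ᴴ)
    (hinv : ∀ p : Fin m, IsUnit (A p p).det)
    (σ v : Fin m → Fin n → ℂ)
    (hsys : ∀ p : Fin m,
      A p p *ᵥ σ p + ∑ q ∈ Finset.univ \ {p}, A p q *ᵥ σ q = -(v p)) :
    ∀ p : Fin m,
      (V p)ᴴ *ᵥ σ p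
        + ∑ q ∈ Finset.univ \ {p},
            (((V p)ᴴ * (A p p)⁻¹ * U p) * Atil p q) *ᵥ ((V q)ᴴ *ᵥ σ q)
      = -((V p)ᴴ *ᵥ ((A p p)⁻¹ *ᵥ v p)) := by
  intro p
  have h := congrArg (fun x => (V p)ᴴ *ᵥ ((A p p)⁻¹ *ᵥ x)) (hsys p)
  simp only [mulVec_add, mulVec_neg, mulVec_sum, mulVec_mulVec,
    Matrix.nonsing_inv_mul _ (hinv p), Matrix.mul_one] at h
  simp only [mulVec_mulVec]
  rw [← h]
  congr 1
  refine Finset.sum_congr rfl fun q hq => ?_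
  have hpq : p ≠ q := by
    rintro rfl
    simp at hq
  rw [hfac p q hpq]
  simp only [Matrix.mul_assoc]
end
end

section
/- (Recovery of the full solution from the compressed system.) Let m, n, k ≥ 1. For p, q ∈ {1,…,m} with p ≠ q, suppose the n×n complex matrices A_{p,q} factor exactly as A_{p,q} = U_p Ã_{p,q} V_q^*, where U_p, V_p are n×k complex matrices and Ã_{p,q} is k×k, and suppose each n×n diagonal block A_{p,p} is invertible. Let v_p ∈ ℂⁿ and set ṽ_p = V_p^* A_{p,p}^{-1} v_p and S_p = V_p^* A_{p,p}^{-1} U_p. Suppose σ̃_p ∈ ℂᵏ satisfy the compressed system σ̃_p + Σ_{q≠p} S_p Ã_{p,q} σ̃_q = −ṽ_p for all p. Define σ_p := −A_{p,p}^{-1}( v_p + Σ_{q≠p} U_p Ã_{p,q} σ̃_q ). Then V_p^* σ_p = σ̃_p for every p, and the vectors σ_p solve the full block system: A_{p,p} σ_p + Σ_{q≠p} A_{p,q} σ_q = −v_p for all p. -/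
noncomputable section

open Matrix

/-- Recovery of the full solution from the compressed system: if the skeleton unknowns
`σ̃_p` solve the compressed system, then the block vectors
`σ_p = −A_{p,p}⁻¹(v_p + Σ_{q≠p} U_p Ã_{p,q} σ̃_q)` satisfy `V_p^* σ_p = σ̃_p` and solve
the full multibody system `A_{p,p} σ_p + Σ_{q≠p} A_{p,q} σ_q = −v_p`. -/
theorem recover_full_solution (m n k : ℕ) (hm : 1 ≤ m) (hn : 1 ≤ n) (hk : 1 ≤ k)
    (A : Fin m → Fin m → Matrix (Fin n) (Fin n) ℂ)
    (U V : Fin m → Matrix (Fin n) (Fin k) ℂ)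
    (Atil : Fin m → Fin m → Matrix (Fin k) (Fin k) ℂ)
    (hfac : ∀ p q : Fin m, p ≠ q → A p q = U p * Atil p q * (V q)ᴴ)
    (hinv : ∀ p : Fin m, IsUnit (A p p).det)
    (v : Fin m → Fin n → ℂ)
    (σtil : Fin m → Fin k → ℂ)
    (hcomp : ∀ p : Fin m,
      σtil p
        + ∑ q ∈ Finset.univ \ {p},
            (((V p)ᴴ * (A p p)⁻¹ * U p) * Atil p q) *ᵥ σtil q
      = -((V p)ᴴ *ᵥ ((A p p)⁻¹ *ᵥ v p)))
    (σ : Fin m → Fin n → ℂ)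
    (hσ : ∀ p : Fin m,
      σ p = -((A p p)⁻¹ *ᵥ
        (v p + ∑ q ∈ Finset.univ \ {p}, (U p * Atil p q) *ᵥ σtil q))) :
    (∀ p : Fin m, (V p)ᴴ *ᵥ σ p = σtil p) ∧
    (∀ p : Fin m,
      A p p *ᵥ σ p + ∑ q ∈ Finset.univ \ {p}, A p q *ᵥ σ q = -(v p)) := by
  have hrec : ∀ p : Fin m, (V p)ᴴ *ᵥ σ p = σtil p := by
    intro p
    rw [hσ p, mulVec_neg, mulVec_add, mulVec_add, neg_add, ← hcomp p, mulVec_sum, mulVec_sum]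
    simp only [mulVec_mulVec, Matrix.mul_assoc, add_neg_cancel_right]
  refine ⟨hrec, fun p => ?_⟩
  have hsum : ∑ q ∈ Finset.univ \ {p}, A p q *ᵥ σ q
      = ∑ q ∈ Finset.univ \ {p}, (U p * Atil p q) *ᵥ σtil q := by
    refine Finset.sum_congr rfl fun q hq => ?_
    have hpq : p ≠ q := by
      rintro rfl
      simp at hq
    rw [hfac p q hpq, ← mulVec_mulVec, hrec q]
  rw [hsum, hσ p, mulVec_neg, mulVec_mulVec, mul_nonsing_inv _ (hinv p), one_mulVec, neg_add,
    neg_add_cancel_right]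
end
end
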